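/- Let n, m be positive integers, let 1 ≤ d ≤ n, and let (k_t)_{t≥1} be a countable collection of weight vectors. Let V ⊆ ℝ^d be a nonempty open set and F : V → ℝⁿ a C¹ map which is a homeomorphism onto its image with everywhere injective differential, and suppose that for every fixed y ∈ ℝ^{d−1} the curve x ↦ F(x,y) (defined on the nonempty slices of V) is everywhere non-degenerate, i.e. each of its n coordinate derivatives is nonvanishing. Then for every Θ ∈ ⋂_{t≥1} Bad(k_t,n,m), the Hausdorff dimension of ⋂_{t≥1} Bad_Θ(k_t,n,m) ∩ F(V) equals d. -/

import Mathlib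

open Real MeasureTheory Topology

/-- Distance from a real number to the nearest integer. -/
noncomputable def distNearestInt (y : ℝ) : ℝ := ⨅ p : ℤ, |y - (p : ℝ)|

/-- `Θᵢ(q) = ∑ⱼ qⱼ Θᵢⱼ` : the `i`-th linear form of `Θ` evaluated at `q ∈ ℤᵐ`. -/
noncomputable def linForm {n m : ℕ} (Θ : Matrix (Fin n) (Fin m) ℝ) (q : Fin m → ℤ)
    (i : Fin n) : ℝ := ∑ j, (q j : ℝ) * Θ i j

/-- `Θ*ⱼ(u) = ∑ᵢ uᵢ Θᵢⱼ` : the `j`-th linear form of the transposed matrix `Θ*`. -/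
noncomputable def dualForm {n m : ℕ} (Θ : Matrix (Fin n) (Fin m) ℝ) (u : Fin n → ℤ)
    (j : Fin m) : ℝ := ∑ i, (u i : ℝ) * Θ i j

/-- The supremum norm `|q|` of an integer vector. -/
noncomputable def supNorm {m : ℕ} (q : Fin m → ℤ) : ℝ := ⨆ j, |(q j : ℝ)|

/-- A weight vector: positive entries summing to 1. -/
def IsWeight {n : ℕ} (k : Fin n → ℝ) : Prop := (∀ i, 0 < k i) ∧ ∑ i, k i = 1

/-- The set `Bad(k,n,m)` of weighted badly approximable `n × m` matrices:
`inf_{q ∈ ℤᵐ, q ≠ 0} max_{1≤i≤n} |q|^{m kᵢ} ‖Θᵢ(q)‖ > 0`. -/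
def Bad (n m : ℕ) (k : Fin n → ℝ) : Set (Matrix (Fin n) (Fin m) ℝ) :=
  {Θ | ∃ c > 0, ∀ q : Fin m → ℤ, q ≠ 0 →
    c ≤ ⨆ i, supNorm q ^ ((m : ℝ) * k i) * distNearestInt (linForm Θ q i)}

/-- The twisted set `Bad_Θ(k,n,m)`:
`{x ∈ ℝⁿ : inf_{q ∈ ℤᵐ, q ≠ 0} max_{1≤i≤n} |q|^{m kᵢ} ‖Θᵢ(q) − xᵢ‖ > 0}`. -/
def BadT (n m : ℕ) (k : Fin n → ℝ) (Θ : Matrix (Fin n) (Fin m) ℝ) : Set (Fin n → ℝ) :=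
  {x | ∃ c > 0, ∀ q : Fin m → ℤ, q ≠ 0 →
    c ≤ ⨆ i, supNorm q ^ ((m : ℝ) * k i) * distNearestInt (linForm Θ q i - x i)}

theorem distNearestInt_eq (y : ℝ) : distNearestInt y = |y - round y| :=
  le_antisymm
    (ciInf_le ⟨0, by rintro _ ⟨p, rfl⟩; exact abs_nonneg _⟩ (round y))
    (le_ciInf fun p => round_le y p)

theorem distNearestInt_le (y : ℝ) (p : ℤ) : distNearestInt y ≤ |y - p| := by
  rw [distNearestInt_eq]; exact round_le y p

theorem distNearestInt_nonneg (y : ℝ) : 0 ≤ distNearestInt y := by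
  rw [distNearestInt_eq]; exact abs_nonneg _

theorem abs_le_supNorm {m : ℕ} (q : Fin m → ℤ) (j : Fin m) : |(q j : ℝ)| ≤ supNorm q :=
  le_ciSup (f := fun j => |(q j : ℝ)|) (Set.finite_range _).bddAbove j

theorem one_le_supNorm {m : ℕ} {q : Fin m → ℤ} (hq : q ≠ 0) : 1 ≤ supNorm q := by
  obtain ⟨j, hj⟩ := Function.ne_iff.1 hq
  refine le_trans ?_ (abs_le_supNorm q j)
  exact_mod_cast Int.one_le_abs hj

theorem supNorm_sub_le {m : ℕ} (hm : 0 < m) (q q' : Fin m → ℤ) :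
    supNorm (q - q') ≤ supNorm q + supNorm q' := by
  have : Nonempty (Fin m) := ⟨⟨0, hm⟩⟩
  refine ciSup_le fun j => ?_
  have h := abs_sub (q j : ℝ) (q' j : ℝ)
  simp only [Pi.sub_apply, Int.cast_sub]
  linarith [abs_le_supNorm q j, abs_le_supNorm q' j]

theorem linForm_sub {n m : ℕ} (Θ : Matrix (Fin n) (Fin m) ℝ) (q q' : Fin m → ℤ) (i : Fin n) :
    linForm Θ (q - q') i = linForm Θ q i - linForm Θ q' i := by
  simp [linForm, sub_mul, Finset.sum_sub_distrib]

/-- Two inhomogeneous approximations by distinct integer vectors give a homogeneous one. -/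
theorem distNearestInt_linForm_sub_le {n m : ℕ} (Θ : Matrix (Fin n) (Fin m) ℝ)
    (q q' : Fin m → ℤ) (i : Fin n) (a b : ℝ) :
    distNearestInt (linForm Θ (q - q') i) ≤ |a - b| +
      distNearestInt (linForm Θ q i - a) + distNearestInt (linForm Θ q' i - b) := by
  rw [distNearestInt_eq (_ - a), distNearestInt_eq (_ - b), linForm_sub]
  refine (distNearestInt_le _ (round (linForm Θ q i - a) - round (linForm Θ q' i - b))).trans ?_
  push_cast
  set s := (round (linForm Θ q i - a) : ℝ)
  set t := (round (linForm Θ q' i - b) : ℝ)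
  have h1 := abs_add_le ((a - b) + (linForm Θ q i - a - s)) (-(linForm Θ q' i - b - t))
  have h2 := abs_add_le (a - b) (linForm Θ q i - a - s)
  rw [abs_neg] at h1
  calc _ = |(a - b) + (linForm Θ q i - a - s) + -(linForm Θ q' i - b - t)| := by
        congr 1; ring
    _ ≤ _ := by linarith

/-- If `y - a` and `y - b` are close to integers and `a`, `b` are close to each other, the two
integers agree, so `|a - b|` is bounded by the approximation errors. -/
theorem abs_sub_le_of_distNearestInt {y a b : ℝ}
    (h : |a - b| + distNearestInt (y - a) + distNearestInt (y - b) < 1) :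
    |a - b| ≤ distNearestInt (y - a) + distNearestInt (y - b) := by
  rw [distNearestInt_eq (y - a), distNearestInt_eq (y - b)] at *
  have hst : round (y - a) = round (y - b) := by
    have : |((round (y - a) - round (y - b) : ℤ) : ℝ)| < 1 := by
      push_cast
      set s := (round (y - a) : ℝ)
      set t := (round (y - b) : ℝ)
      calc |s - t| = |(-(a - b) + -(y - a - s)) + (y - b - t)| := by congr 1; ring
        _ ≤ |(-(a - b) + -(y - a - s))| + |y - b - t| := abs_add_le _ _
        _ ≤ |a - b| + |y - a - s| + |y - b - t| := by
          have := abs_add_le (-(a - b)) (-(y - a - s))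
          rw [abs_neg, abs_neg] at this
          linarith
        _ < 1 := h
    rw [← Int.cast_abs] at this
    have h0 : |round (y - a) - round (y - b)| < 1 := by exact_mod_cast this
    exact sub_eq_zero.1 (Int.abs_lt_one_iff.1 h0)
  rw [← hst]
  set s := (round (y - a) : ℝ)
  calc |a - b| = |(y - b - s) - (y - a - s)| := by congr 1; ring
    _ ≤ |y - b - s| + |y - a - s| := abs_sub _ _
    _ = _ := add_comm _ _

/-- At scale `r`, all points of a small box that are dangerously close to a translate
`Θ(q) + ℤⁿ` with `|q|` in a fixed window have nearly equal coordinate of maximal weight. -/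
theorem abs_sub_le_of_window {n m : ℕ} (hn : 0 < n) (hm : 0 < m) {k : Fin n → ℝ}
    (hk : IsWeight k) {Θ : Matrix (Fin n) (Fin m) ℝ} {c : ℝ}
    (hΘ : ∀ q : Fin m → ℤ, q ≠ 0 →
      c ≤ ⨆ i, supNorm q ^ ((m : ℝ) * k i) * distNearestInt (linForm Θ q i))
    {i₁ : Fin n} (hi₁ : ∀ i, k i ≤ k i₁) {M r τ A ε : ℝ} (hc : 0 < c) (hr : 0 < r)
    (hM : 0 < M) (hMr : M * r ≤ 1 / 2) (hA : 0 < A) (hτ₀ : 0 < τ) (hε₀ : 0 < ε)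
    (hτ : 2 ^ ((m : ℝ) * k i₁) * (M * τ) ≤ c / 4)
    (hε : 2 ^ ((m : ℝ) * k i₁) * (2 * (ε * A)) ≤ c / 4) (hε' : ε ≤ 1 / 8)
    {x x' : Fin n → ℝ} (hxx : ∀ i, |x i - x' i| ≤ M * r)
    {q q' : Fin m → ℤ} (hq : q ≠ 0) (hq' : q' ≠ 0)
    (hw₁ : supNorm q ^ ((m : ℝ) * k i₁) * r ≤ τ)
    (hw₂ : τ ≤ A * (supNorm q ^ ((m : ℝ) * k i₁) * r))
    (hw₁' : supNorm q' ^ ((m : ℝ) * k i₁) * r ≤ τ)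
    (hw₂' : τ ≤ A * (supNorm q' ^ ((m : ℝ) * k i₁) * r))
    (hx : ∀ i, supNorm q ^ ((m : ℝ) * k i) * distNearestInt (linForm Θ q i - x i) < ε)
    (hx' : ∀ i, supNorm q' ^ ((m : ℝ) * k i) * distNearestInt (linForm Θ q' i - x' i) < ε) :
    |x i₁ - x' i₁| ≤ 2 * ε * A * r / τ := by
  have : Nonempty (Fin n) := ⟨⟨0, hn⟩⟩
  have hκ : ∀ i, 0 < (m : ℝ) * k i := fun i => mul_pos (by exact_mod_cast hm) (hk.1 i)
  have hκle : ∀ i, (m : ℝ) * k i ≤ m * k i₁ := fun i =>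
    mul_le_mul_of_nonneg_left (hi₁ i) (by positivity)
  have hQ := one_le_supNorm hq
  have hQ' := one_le_supNorm hq'
  have key : ∀ {Q R e : ℝ} (i : Fin n), 1 ≤ Q → Q ≤ R → R ^ ((m : ℝ) * k i₁) * r ≤ τ →
      τ ≤ A * (Q ^ ((m : ℝ) * k i₁) * r) → Q ^ ((m : ℝ) * k i) * e < ε →
      R ^ ((m : ℝ) * k i) * e ≤ ε * A := by
    intro Q R e i h1 h2 h3 h4 h5
    have hQ0 : 0 < Q := by linarith
    have hR0 : 0 < R := by linarith
    have hA' : (R / Q) ^ ((m : ℝ) * k i₁) ≤ A := by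
      rw [div_rpow hR0.le hQ0.le, div_le_iff₀ (rpow_pos_of_pos hQ0 _)]
      have : R ^ ((m : ℝ) * k i₁) * r ≤ A * Q ^ ((m : ℝ) * k i₁) * r := by linarith
      exact le_of_mul_le_mul_right this hr
    have h6 : (R / Q) ^ ((m : ℝ) * k i) ≤ A :=
      (rpow_le_rpow_of_exponent_le ((one_le_div hQ0).2 h2) (hκle i)).trans hA'
    calc R ^ ((m : ℝ) * k i) * e = (R / Q) ^ ((m : ℝ) * k i) * (Q ^ ((m : ℝ) * k i) * e) := by
          rw [div_rpow hR0.le hQ0.le]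
          field_simp [(rpow_pos_of_pos hQ0 ((m : ℝ) * k i)).ne']
      _ ≤ (R / Q) ^ ((m : ℝ) * k i) * ε := by gcongr
      _ ≤ A * ε := by gcongr
      _ = ε * A := mul_comm _ _
  by_cases hqq : q = q'
  · subst hqq
    have hle : ∀ {a : ℝ}, supNorm q ^ ((m : ℝ) * k i₁) * a < ε → 0 ≤ a → a < ε := by
      intro a h ha
      have := one_le_rpow hQ (hκ i₁).le
      nlinarith
    have h1 := hle (hx i₁) (distNearestInt_nonneg _)
    have h2 := hle (hx' i₁) (distNearestInt_nonneg _)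
    have h3 := abs_sub_le_of_distNearestInt (y := linForm Θ q i₁) (a := x i₁) (b := x' i₁)
      (by linarith [hxx i₁])
    rw [le_div_iff₀ hτ₀]
    have h0 : 0 < supNorm q ^ ((m : ℝ) * k i₁) := rpow_pos_of_pos (by linarith) _
    calc |x i₁ - x' i₁| * τ ≤ |x i₁ - x' i₁| * (A * (supNorm q ^ ((m : ℝ) * k i₁) * r)) := by
          gcongr
      _ = A * r * (supNorm q ^ ((m : ℝ) * k i₁) * |x i₁ - x' i₁|) := by ring
      _ ≤ A * r * (supNorm q ^ ((m : ℝ) * k i₁) *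
          (distNearestInt (linForm Θ q i₁ - x i₁) + distNearestInt (linForm Θ q i₁ - x' i₁))) := by
          gcongr
      _ ≤ A * r * (ε + ε) := by
          gcongr
          linarith [hx i₁, hx' i₁]
      _ = _ := by ring
  · exfalso
    obtain ⟨i, hi⟩ := exists_eq_ciSup_of_finite
      (f := fun i => supNorm (q - q') ^ ((m : ℝ) * k i) * distNearestInt (linForm Θ (q - q') i))
    have hci := hΘ (q - q') (sub_ne_zero.2 hqq)
    rw [← hi] at hci
    set R := max (supNorm q) (supNorm q')
    have hR1 : 1 ≤ R := hQ.trans (le_max_left _ _)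
    have hRτ : R ^ ((m : ℝ) * k i₁) * r ≤ τ := by
      rcases max_choice (supNorm q) (supNorm q') with h | h <;> simpa only [R, h]
    have hsub : supNorm (q - q') ≤ 2 * R := by
      linarith [supNorm_sub_le hm q q', le_max_left (supNorm q) (supNorm q'),
        le_max_right (supNorm q) (supNorm q')]
    have hpos : 0 ≤ supNorm (q - q') := by
      linarith [one_le_supNorm (sub_ne_zero.2 hqq)]
    have e1 := key i hQ (le_max_left _ _) hRτ hw₂ (hx i)
    have e2 := key i hQ' (le_max_right _ _) hRτ hw₂' (hx' i)
    have e3 : R ^ ((m : ℝ) * k i) * (M * r) ≤ M * τ := by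
      have : R ^ ((m : ℝ) * k i) * r ≤ τ := le_trans
        (mul_le_mul_of_nonneg_right (rpow_le_rpow_of_exponent_le hR1 (hκle i)) hr.le) hRτ
      nlinarith
    have hR0 : 0 ≤ R := by linarith
    have : c ≤ c / 2 := by
      calc c ≤ supNorm (q - q') ^ ((m : ℝ) * k i) * distNearestInt (linForm Θ (q - q') i) := hci
        _ ≤ (2 * R) ^ ((m : ℝ) * k i) * (M * r + distNearestInt (linForm Θ q i - x i) +
              distNearestInt (linForm Θ q' i - x' i)) := by
            refine mul_le_mul (rpow_le_rpow hpos hsub (hκ i).le) ?_ (distNearestInt_nonneg _)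
              (by positivity)
            linarith [distNearestInt_linForm_sub_le Θ q q' i (x i) (x' i), hxx i]
        _ = 2 ^ ((m : ℝ) * k i) * (R ^ ((m : ℝ) * k i) * (M * r) +
              R ^ ((m : ℝ) * k i) * distNearestInt (linForm Θ q i - x i) +
              R ^ ((m : ℝ) * k i) * distNearestInt (linForm Θ q' i - x' i)) := by
            rw [mul_rpow (by norm_num) hR0]; ring
        _ ≤ 2 ^ ((m : ℝ) * k i) * (M * τ + ε * A + ε * A) := by gcongr
        _ ≤ 2 ^ ((m : ℝ) * k i₁) * (M * τ + ε * A + ε * A) := by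
            gcongr
            · norm_num
            · exact hi₁ i
        _ ≤ c / 2 := by linarith
    linarith

/-- Avoiding a family of dangerous sets, one for each scale `r₀ N⁻ˡ` with `l` in a syndetic set
of levels, forces a point into `BadT`; within boxes of size comparable to the scale, each
dangerous set is thin in a fixed coordinate direction. -/
theorem exists_dangerous_sets {n m : ℕ} (hn : 0 < n) (hm : 0 < m) {k : Fin n → ℝ}
    (hk : IsWeight k) {Θ : Matrix (Fin n) (Fin m) ℝ} (hΘ : Θ ∈ Bad n m k)
    {M r₀ N : ℝ} (hM : 0 < M) (hr₀ : 0 < r₀) (hMr : M * r₀ ≤ 1 / 2) (hN : 1 < N)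
    {S : Set ℕ} {G : ℕ} (hS : ∀ l, ∃ l' ∈ S, l ≤ l' ∧ l' ≤ l + G) :
    ∃ i₁ : Fin n, ∃ D : ℕ → Set (Fin n → ℝ),
      (∀ l, ∀ x ∈ D l, ∀ x' ∈ D l, (∀ i, |x i - x' i| ≤ M * (r₀ / N ^ l)) →
        |x i₁ - x' i₁| ≤ r₀ / N ^ (l + 1)) ∧
      ∀ x, (∀ l ∈ S, x ∉ D l) → x ∈ BadT n m k Θ := by
  have : Nonempty (Fin n) := ⟨⟨0, hn⟩⟩
  obtain ⟨i₁, hi₁⟩ := Finite.exists_max k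
  obtain ⟨c, hc, hΘ⟩ := hΘ
  have hN0 : 0 < N := by linarith
  set κ : ℝ := (m : ℝ) * k i₁ with hκdef
  have hκ : 0 < κ := mul_pos (by exact_mod_cast hm) (hk.1 i₁)
  have h2κ : 0 < (2 : ℝ) ^ κ := by positivity
  set τ : ℝ := c / (4 * 2 ^ κ * M) with hτdef
  have hτ₀ : 0 < τ := by positivity
  set A : ℝ := max (N ^ (G + 1)) (τ * N ^ G / r₀) with hAdef
  have hA : 0 < A := lt_max_of_lt_left (by positivity)
  obtain ⟨ε, hε₀, hε1, hε2, hε3⟩ : ∃ ε : ℝ, 0 < ε ∧ ε ≤ 1 / 8 ∧ 2 ^ κ * (2 * (ε * A)) ≤ c / 4 ∧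
      2 * ε * A * N ≤ τ := by
    refine ⟨min (1 / 8) (min (c / (8 * 2 ^ κ * A)) (τ / (2 * A * N))), by positivity,
      min_le_left _ _, ?_, ?_⟩
    · have : min (1 / 8) (min (c / (8 * 2 ^ κ * A)) (τ / (2 * A * N))) ≤ c / (8 * 2 ^ κ * A) :=
        (min_le_right _ _).trans (min_le_left _ _)
      rw [le_div_iff₀ (by positivity)] at this
      linarith
    · have : min (1 / 8) (min (c / (8 * 2 ^ κ * A)) (τ / (2 * A * N))) ≤ τ / (2 * A * N) :=
        (min_le_right _ _).trans (min_le_right _ _)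
      rw [le_div_iff₀ (by positivity)] at this
      linarith
  refine ⟨i₁, fun l => {x | ∃ q : Fin m → ℤ, q ≠ 0 ∧ supNorm q ^ κ * (r₀ / N ^ l) ≤ τ ∧
    τ ≤ A * (supNorm q ^ κ * (r₀ / N ^ l)) ∧
    ∀ i, supNorm q ^ ((m : ℝ) * k i) * distNearestInt (linForm Θ q i - x i) < ε}, ?_, ?_⟩
  · rintro l x ⟨q, hq, hw₁, hw₂, hx⟩ x' ⟨q', hq', hw₁', hw₂', hx'⟩ hxx
    have hr : 0 < r₀ / N ^ l := by positivity
    have hle : r₀ / N ^ l ≤ r₀ := div_le_self hr₀.le (one_le_pow₀ hN.le)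
    refine (abs_sub_le_of_window hn hm hk hΘ hi₁ hc hr hM
      (le_trans (by gcongr) hMr) hA hτ₀ hε₀ ?_ hε2 hε1 hxx hq hq' hw₁ hw₂ hw₁' hw₂' hx hx').trans ?_
    · rw [← hκdef, hτdef]; apply le_of_eq; field_simp
    · rw [pow_succ, ← div_div, div_le_div_iff₀ hτ₀ hN0]
      nlinarith
  · intro x hx
    refine ⟨ε, hε₀, fun q hq => ?_⟩
    have hQ := one_le_supNorm hq
    have hQκ : 1 ≤ supNorm q ^ κ := one_le_rpow hQ hκ.le
    have hQ0 : 0 < supNorm q ^ κ := by linarith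
    have hex : ∃ l : ℕ, supNorm q ^ κ * (r₀ / N ^ l) ≤ τ := by
      obtain ⟨l, hl⟩ := pow_unbounded_of_one_lt (supNorm q ^ κ * r₀ / τ) hN
      refine ⟨l, ?_⟩
      rw [← mul_div_assoc, div_le_iff₀ (by positivity)]
      rw [div_lt_iff₀ hτ₀] at hl
      linarith
    classical
    obtain ⟨l', hl'S, hl1, hl2⟩ := hS (Nat.find hex)
    have hw₁ : supNorm q ^ κ * (r₀ / N ^ l') ≤ τ := by
      refine le_trans ?_ (Nat.find_spec hex)
      have := hN.le
      gcongr
    have hw₂ : τ ≤ A * (supNorm q ^ κ * (r₀ / N ^ l')) := by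
      have hstep : supNorm q ^ κ * (r₀ / N ^ (Nat.find hex + G)) ≤
          supNorm q ^ κ * (r₀ / N ^ l') := by
        have := hN.le
        gcongr
      refine le_trans ?_ (mul_le_mul_of_nonneg_left hstep hA.le)
      rcases Nat.eq_zero_or_pos (Nat.find hex) with h0 | h0
      · rw [h0, zero_add]
        calc τ = τ * N ^ G / r₀ * (1 * (r₀ / N ^ G)) := by field_simp
          _ ≤ A * (supNorm q ^ κ * (r₀ / N ^ G)) := by
            gcongr
            exact le_max_right _ _
      · obtain ⟨l, hl⟩ := Nat.exists_eq_succ_of_ne_zero h0.ne'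
        have := Nat.find_min hex (m := l) (by omega)
        rw [not_le] at this
        rw [hl]
        calc τ ≤ supNorm q ^ κ * (r₀ / N ^ l) := this.le
          _ = N ^ (G + 1) * (supNorm q ^ κ * (r₀ / N ^ (l.succ + G))) := by
            rw [Nat.succ_eq_add_one, show l + 1 + G = l + (G + 1) by ring, pow_add N l]
            field_simp
          _ ≤ _ := by
            gcongr
            exact le_max_left _ _
    have hnot := hx l' hl'S
    simp only [Set.mem_ofPred_eq, not_exists, not_and] at hnot
    have := hnot q hq hw₁ hw₂
    push Not at this
    obtain ⟨i, hi⟩ := this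
    exact hi.trans (le_ciSup (f := fun i => supNorm q ^ ((m : ℝ) * k i) *
      distNearestInt (linForm Θ q i - x i)) (Set.finite_range _).bddAbove i)

/-- Levels can be distributed among countably many constraints so that each constraint is
served at a syndetic set of levels. -/
theorem exists_schedule : ∃ σ : ℕ → ℕ, ∀ t, ∃ G, ∀ l, ∃ l' ∈ {l | σ l = t}, l ≤ l' ∧ l' ≤ l + G := by
  refine ⟨fun l => padicValNat 2 (l + 1), fun t => ⟨2 ^ (t + 1) + 2 ^ t, fun l => ?_⟩⟩
  set a := l / 2 ^ (t + 1)
  have h1 : 2 ^ (t + 1) * a + l % 2 ^ (t + 1) = l := Nat.div_add_mod l (2 ^ (t + 1))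
  have h2 := Nat.mod_lt l (show 0 < 2 ^ (t + 1) by positivity)
  have h3 : 0 < 2 ^ t := by positivity
  have h4 : 2 ^ (t + 1) * (a + 1) + 2 ^ t - 1 + 1 = 2 ^ t * (2 * (a + 1) + 1) := by
    rw [Nat.sub_add_cancel (by omega)]; ring
  refine ⟨2 ^ (t + 1) * (a + 1) + 2 ^ t - 1, ?_, ?_, ?_⟩
  · simp only [Set.mem_ofPred_eq]
    have : Fact (Nat.Prime 2) := ⟨Nat.prime_two⟩
    rw [h4, padicValNat.mul (by positivity) (by positivity), padicValNat.prime_pow,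
      padicValNat.eq_zero_of_not_dvd (by omega), add_zero]
  · have := mul_add (2 ^ (t + 1)) a 1; omega
  · have := mul_add (2 ^ (t + 1)) a 1; omega

/-- The `l`-th digit in base `P` of each coordinate of `y`. -/
noncomputable def baseDigit {d : ℕ} (P : ℕ) (y : Fin d → ℝ) (l : ℕ) (j : Fin d) : ℕ :=
  ⌊(P : ℝ) ^ (l + 1) * y j⌋₊ % P

theorem abs_sub_le_of_baseDigit_eq {d P : ℕ} (hP : 0 < P) {y y' : Fin d → ℝ}
    (hy : ∀ j, 0 ≤ y j ∧ y j < 1) (hy' : ∀ j, 0 ≤ y' j ∧ y' j < 1) {l : ℕ} {j : Fin d}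
    (h : ∀ l' < l, baseDigit P y l' j = baseDigit P y' l' j) :
    |y j - y' j| ≤ 1 / (P : ℝ) ^ l := by
  have hP0 : (0 : ℝ) < P := by exact_mod_cast hP
  have hfloor : ∀ l' ≤ l, ⌊(P : ℝ) ^ l' * y j⌋₊ = ⌊(P : ℝ) ^ l' * y' j⌋₊ := by
    intro l'
    induction l' with
    | zero => simp [Nat.floor_eq_zero.2 (hy j).2, Nat.floor_eq_zero.2 (hy' j).2]
    | succ a ih =>
      intro ha
      have hdiv : ∀ z : ℝ, ⌊(P : ℝ) ^ (a + 1) * z⌋₊ / P = ⌊(P : ℝ) ^ a * z⌋₊ := by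
        intro z
        rw [← Nat.floor_div_natCast]
        congr 1
        rw [pow_succ]
        field_simp
      rw [← Nat.div_add_mod ⌊(P : ℝ) ^ (a + 1) * y j⌋₊ P,
        ← Nat.div_add_mod ⌊(P : ℝ) ^ (a + 1) * y' j⌋₊ P, hdiv, hdiv, ih (by omega)]
      exact congrArg _ (h a (by omega))
  have hl := hfloor l le_rfl
  have hpos : (0 : ℝ) < (P : ℝ) ^ l := by positivity
  have h1 := Nat.floor_le (mul_nonneg hpos.le (hy j).1)
  have h2 := Nat.lt_floor_add_one ((P : ℝ) ^ l * y j)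
  have h3 := Nat.floor_le (mul_nonneg hpos.le (hy' j).1)
  have h4 := Nat.lt_floor_add_one ((P : ℝ) ^ l * y' j)
  rw [hl] at h1 h2
  rw [le_div_iff₀ hpos]
  nth_rw 1 [← abs_of_pos hpos]
  rw [← abs_mul, abs_le]
  constructor <;> linarith

open Classical in
/-- Shift, in units of `r`, which moves a column of cells with corner `c` and column index `w` away
from the set `B` whenever `B` meets the left half of the column. -/
noncomputable def columnShift {d : ℕ} (i₀ : Fin d) (P C : ℕ) (r : ℝ) (B : Set (Fin d → ℝ))
    (c : Fin d → ℝ) (w : Fin d → ℕ) : ℕ :=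
  if ∃ p ∈ B, (∀ j ≠ i₀, c j + 2 * w j * r ≤ p j ∧ p j ≤ c j + (2 * w j + 1) * r) ∧
    c i₀ ≤ p i₀ ∧ p i₀ ≤ c i₀ + (2 * P - 1) * r then 2 * P + C else 0

theorem columnShift_congr {d : ℕ} {i₀ : Fin d} {P C : ℕ} {r : ℝ} {B : Set (Fin d → ℝ)}
    {c : Fin d → ℝ} {w w' : Fin d → ℕ} (h : ∀ j ≠ i₀, w j = w' j) :
    columnShift i₀ P C r B c w = columnShift i₀ P C r B c w' := by
  unfold columnShift
  classical
  refine if_congr (exists_congr fun p => and_congr_right fun _ => and_congr_left fun _ => ?_) rfl rfl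
  exact forall₂_congr fun j hj => by rw [h j hj]

theorem columnShift_le {d : ℕ} (i₀ : Fin d) (P C : ℕ) (r : ℝ) (B : Set (Fin d → ℝ))
    (c : Fin d → ℝ) (w : Fin d → ℕ) : columnShift i₀ P C r B c w ≤ 2 * P + C := by
  unfold columnShift
  split_ifs <;> omega

/-- If `B` is thin in direction `i₀`, the shifted cell does not meet it. -/
theorem notMem_of_columnShift {d : ℕ} {i₀ : Fin d} {P C : ℕ} {r : ℝ} (hr : 0 < r)
    {B : Set (Fin d → ℝ)}
    (hB : ∀ p ∈ B, ∀ p' ∈ B, (∀ j, |p j - p' j| ≤ (4 * P + C) * r) →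
      (∀ j ≠ i₀, |p j - p' j| ≤ r) → |p i₀ - p' i₀| ≤ C * r)
    {c : Fin d → ℝ} {w : Fin d → ℕ} (hw : ∀ j, w j < P) {x : Fin d → ℝ}
    (hx : ∀ j ≠ i₀, c j + 2 * w j * r ≤ x j ∧ x j ≤ c j + (2 * w j + 1) * r)
    (hx₀ : c i₀ + (2 * w i₀ + columnShift i₀ P C r B c w) * r ≤ x i₀)
    (hx₁ : x i₀ ≤ c i₀ + (2 * w i₀ + columnShift i₀ P C r B c w + 1) * r) : x ∉ B := by
  intro hxB
  have hwP : (w i₀ : ℝ) + 1 ≤ P := by exact_mod_cast hw i₀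
  have hw0 : (0 : ℝ) ≤ w i₀ := by positivity
  have hC0 : (0 : ℝ) ≤ C := by positivity
  unfold columnShift at hx₀ hx₁
  split_ifs at hx₀ hx₁ with h
  · obtain ⟨p, hpB, hp, hp₀, hp₁⟩ := h
    push_cast at hx₀ hx₁
    have hj : ∀ j ≠ i₀, |x j - p j| ≤ r := fun j hj => by
      have h1 := hx j hj
      have h2 := hp j hj
      rw [abs_le]; constructor <;> nlinarith
    have hi : |x i₀ - p i₀| ≤ (4 * P + C) * r := by
      rw [abs_le]; constructor <;> nlinarith
    have := hB x hxB p hpB (fun j => ?_) hj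
    · have := (abs_le.1 this).2
      nlinarith
    · by_cases hji : j = i₀
      · rw [hji]; exact hi
      · refine (hj j hji).trans ?_
        nlinarith
  · refine h ⟨x, hxB, hx, ?_, ?_⟩
    · push_cast at hx₀
      nlinarith
    · push_cast at hx₁
      nlinarith

/-- The corner of the level `l` cell containing the point with digit expansion `y`. -/
noncomputable def cellCorner {d : ℕ} (i₀ : Fin d) (P C : ℕ) (r₀ : ℝ) (c₀ : Fin d → ℝ)
    (B : ℕ → Set (Fin d → ℝ)) (y : Fin d → ℝ) : ℕ → Fin d → ℝ
  | 0 => c₀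
  | l + 1 => fun j => cellCorner i₀ P C r₀ c₀ B y l j + (2 * baseDigit P y l j +
      if j = i₀ then (columnShift i₀ P C (r₀ / (4 * P + C) ^ (l + 1)) (B l)
        (cellCorner i₀ P C r₀ c₀ B y l) (baseDigit P y l) : ℝ) else 0) *
      (r₀ / (4 * P + C) ^ (l + 1))

theorem cellCorner_congr {d : ℕ} {i₀ : Fin d} {P C : ℕ} {r₀ : ℝ} {c₀ : Fin d → ℝ}
    {B : ℕ → Set (Fin d → ℝ)} {y y' : Fin d → ℝ} {l : ℕ}
    (h : ∀ l' < l, baseDigit P y l' = baseDigit P y' l') :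
    cellCorner i₀ P C r₀ c₀ B y l = cellCorner i₀ P C r₀ c₀ B y' l := by
  induction l with
  | zero => rfl
  | succ l ih =>
    simp only [cellCorner, ih fun l' hl' => h l' (by omega), h l (by omega)]

/-- A Cantor-like set avoiding sets `B l` that are thin in direction `i₀` at scale
`r₀ / (4 P + C) ^ l`, parametrized by base `P` expansions. -/
theorem exists_cantor_avoiding {d P C : ℕ} (i₀ : Fin d) (hP : 2 ≤ P) {r₀ : ℝ} (hr₀ : 0 < r₀)
    (c₀ : Fin d → ℝ) {B : ℕ → Set (Fin d → ℝ)}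
    (hB : ∀ l, ∀ p ∈ B l, ∀ p' ∈ B l, (∀ j, |p j - p' j| ≤ r₀ / (4 * P + C) ^ l) →
      (∀ j ≠ i₀, |p j - p' j| ≤ r₀ / (4 * P + C) ^ (l + 1)) →
      |p i₀ - p' i₀| ≤ C * (r₀ / (4 * P + C) ^ (l + 1))) :
    ∃ φ : (Fin d → ℝ) → (Fin d → ℝ),
      (∀ y j, c₀ j ≤ φ y j ∧ φ y j ≤ c₀ j + r₀) ∧ (∀ y l, φ y ∉ B l) ∧
      ∀ y y', (∀ j, 0 ≤ y j ∧ y j < 1) → (∀ j, 0 ≤ y' j ∧ y' j < 1) → y ≠ y' →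
        ∃ l : ℕ, dist y y' ≤ 1 / (P : ℝ) ^ l ∧ r₀ / (4 * P + C) ^ (l + 1) ≤ dist (φ y) (φ y') := by
  set N : ℝ := 4 * P + C with hN
  have hP0 : 0 < P := by omega
  have hP1 : (1 : ℝ) ≤ P := by exact_mod_cast hP0
  have hC0 : (0 : ℝ) ≤ C := by positivity
  have hN0 : 0 < N := by positivity
  set r : ℕ → ℝ := fun l => r₀ / N ^ l with hrdef
  have hr : ∀ l, 0 < r l := fun l => by positivity
  have hrs : ∀ l, N * r (l + 1) = r l := fun l => by
    simp only [hrdef, pow_succ]; field_simp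
  set K : (Fin d → ℝ) → ℕ → Fin d → ℝ := cellCorner i₀ P C r₀ c₀ B with hK
  set σ : (Fin d → ℝ) → ℕ → ℕ := fun y l =>
    columnShift i₀ P C (r (l + 1)) (B l) (K y l) (baseDigit P y l) with hσ
  have hKs : ∀ y l j, K y (l + 1) j = K y l j +
      (2 * baseDigit P y l j + if j = i₀ then (σ y l : ℝ) else 0) * r (l + 1) :=
    fun y l j => rfl
  have hdig : ∀ (y : Fin d → ℝ) l j, baseDigit P y l j < P := fun y l j => Nat.mod_lt _ hP0
  have hdig' : ∀ (y : Fin d → ℝ) l j, (baseDigit P y l j : ℝ) + 1 ≤ P := fun y l j => by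
    exact_mod_cast hdig y l j
  have hσle : ∀ y l, (σ y l : ℝ) ≤ 2 * P + C := fun y l => by
    exact_mod_cast columnShift_le _ _ _ _ _ _ _
  have hbr : ∀ y l j, 0 ≤ (2 * baseDigit P y l j + if j = i₀ then (σ y l : ℝ) else 0) ∧
      (2 * baseDigit P y l j + if j = i₀ then (σ y l : ℝ) else 0) + 1 ≤ N := by
    intro y l j
    have h1 := hdig' y l j
    have h2 := hσle y l
    constructor
    · positivity
    · split_ifs <;> linarith
  have hmono : ∀ y j, Monotone fun l => K y l j := fun y j =>
    monotone_nat_of_le_succ fun l => by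
      rw [hKs]
      have := mul_nonneg (hbr y l j).1 (hr (l + 1)).le
      linarith
  have hanti : ∀ y j, Antitone fun l => K y l j + r l := fun y j =>
    antitone_nat_of_succ_le fun l => by
      rw [hKs, ← hrs l]
      have := mul_le_mul_of_nonneg_right (hbr y l j).2 (hr (l + 1)).le
      linarith
  set φ : (Fin d → ℝ) → Fin d → ℝ := fun y j => ⨆ l, K y l j
  have hφ : ∀ y j l, K y l j ≤ φ y j ∧ φ y j ≤ K y l j + r l := fun y j l =>
    Set.mem_iInter.1 ((hmono y j).ciSup_mem_iInter_Icc_of_antitone (hanti y j)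
      fun l => le_add_of_nonneg_right (hr l).le) l
  refine ⟨φ, fun y j => ?_, fun y l => ?_, fun y y' hy hy' hne => ?_⟩
  · have := hφ y j 0
    simpa [hK, cellCorner, hrdef] using this
  · have hcell : ∀ j, K y l j + (2 * baseDigit P y l j + if j = i₀ then (σ y l : ℝ) else 0) *
          r (l + 1) ≤ φ y j ∧ φ y j ≤ K y l j +
          (2 * baseDigit P y l j + (if j = i₀ then (σ y l : ℝ) else 0) + 1) * r (l + 1) := by
      intro j
      have := hφ y j (l + 1)
      rw [hKs] at this
      constructor <;> linarith
    refine notMem_of_columnShift (i₀ := i₀) (P := P) (C := C) (B := B l) (c := K y l) (hr (l + 1)) ?_ (hdig y l)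
      (fun j hj => by simpa only [if_neg hj, add_zero] using hcell j) (by simpa using (hcell i₀).1)
      (by simpa using (hcell i₀).2)
    rw [← hN, hrs]
    exact hB l
  · have hex : ∃ l, baseDigit P y l ≠ baseDigit P y' l := by
      by_contra! hall
      refine hne (funext fun j => ?_)
      by_contra hj
      have hpos : 0 < |y j - y' j| := abs_pos.2 (sub_ne_zero.2 hj)
      obtain ⟨l, hl⟩ := exists_pow_lt_of_lt_one hpos
        (show (1 / P : ℝ) < 1 by
          rw [div_lt_one (by positivity)]; exact_mod_cast hP)
      have := abs_sub_le_of_baseDigit_eq hP0 hy hy' (l := l) (j := j)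
        fun l' _ => congrFun (hall l') j
      rw [div_pow, one_pow] at hl
      linarith
    classical
    set l := Nat.find hex
    have hlt : ∀ l' < l, baseDigit P y l' = baseDigit P y' l' := fun l' hl' =>
      not_not.1 (Nat.find_min hex hl')
    have hKeq : K y l = K y' l := cellCorner_congr hlt
    refine ⟨l, (dist_pi_le_iff (by positivity)).2 fun j => ?_, ?_⟩
    · rw [Real.dist_eq]
      exact abs_sub_le_of_baseDigit_eq hP0 hy hy' fun l' hl' => congrFun (hlt l' hl') j
    · have hsep : ∀ j, (if j = i₀ then (σ y l : ℝ) else 0) = (if j = i₀ then (σ y' l : ℝ) else 0) →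
          baseDigit P y l j ≠ baseDigit P y' l j → r (l + 1) ≤ dist (φ y) (φ y') := by
        intro j hs hj
        refine le_trans ?_ (dist_le_pi_dist (φ y) (φ y') j)
        rw [Real.dist_eq]
        have h1 := hφ y j (l + 1)
        have h2 := hφ y' j (l + 1)
        rw [hKs, hKeq, hs] at h1
        rw [hKs] at h2
        have hrl := hr (l + 1)
        rcases lt_or_gt_of_ne hj with h | h
        · have h' : (baseDigit P y l j : ℝ) + 1 ≤ baseDigit P y' l j := by exact_mod_cast h
          rw [abs_sub_comm]
          refine le_trans ?_ (le_abs_self _)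
          nlinarith
        · have h' : (baseDigit P y' l j : ℝ) + 1 ≤ baseDigit P y l j := by exact_mod_cast h
          refine le_trans ?_ (le_abs_self _)
          nlinarith
      by_cases hcol : ∀ j ≠ i₀, baseDigit P y l j = baseDigit P y' l j
      · have hσeq : σ y l = σ y' l := by
          simp only [hσ, hKeq]
          exact columnShift_congr hcol
        obtain ⟨j, hj⟩ := Function.ne_iff.1 (Nat.find_spec hex)
        exact hsep j (by rw [hσeq]) hj
      · push Not at hcol
        obtain ⟨j, hji, hj⟩ := hcol
        exact hsep j (by simp [hji]) hj

theorem mul_dimH_le_dimH_image {X Y : Type*} [MetricSpace X] [MetricSpace Y] {f : X → Y} {Q : Set X}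
    {C s : NNReal} (hs : 0 < s)
    (h : ∀ x ∈ Q, ∀ y ∈ Q, dist x y ≤ C * dist (f x) (f y) ^ (s : ℝ)) :
    s * dimH Q ≤ dimH (f '' Q) := by
  rcases Q.eq_empty_or_nonempty with rfl | ⟨x₀, hx₀⟩
  · simp
  have : Nonempty X := ⟨x₀⟩
  have hs' : (0 : ℝ) < s := hs
  have hinj : Set.InjOn f Q := fun x hx y hy hxy => by
    have := h x hx y hy
    rw [hxy, dist_self, zero_rpow hs'.ne', mul_zero] at this
    exact dist_le_zero.1 this
  have hg := hinj.leftInvOn_invFunOn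
  have hholder : HolderOnWith C s (Function.invFunOn f Q) (f '' Q) := by
    rintro _ ⟨x, hx, rfl⟩ _ ⟨y, hy, rfl⟩
    rw [hg hx, hg hy, edist_dist, edist_dist, ENNReal.ofReal_rpow_of_nonneg dist_nonneg hs'.le,
      ← ENNReal.ofReal_coe_nnreal (p := C), ← ENNReal.ofReal_mul C.coe_nonneg]
    exact ENNReal.ofReal_le_ofReal (h x hx y hy)
  have := hholder.dimH_image_le hs
  rw [hg.image_image] at this
  rw [ENNReal.le_div_iff_mul_le (Or.inl (by simpa using hs.ne')) (Or.inl ENNReal.coe_ne_top)] at this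
  rwa [mul_comm]

theorem dimH_unit_cube (d : ℕ) : dimH {y : Fin d → ℝ | ∀ j, 0 ≤ y j ∧ y j < 1} = d := by
  have : {y : Fin d → ℝ | ∀ j, 0 ≤ y j ∧ y j < 1} = Set.pi Set.univ fun _ => Set.Ico 0 1 := by
    ext y; simp
  rw [this, dimH_of_nonempty_interior, Module.finrank_fin_fun]
  rw [interior_pi_set Set.finite_univ]
  refine ⟨fun _ => 1 / 2, fun j _ => ?_⟩
  simp only [interior_Ico]
  norm_num

theorem exists_base (C : ℕ) {s : ℝ} (hs0 : 0 < s) (hs : s < 1) :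
    ∃ P : ℕ, 2 ≤ P ∧ (4 * P + C : ℝ) ^ s ≤ P := by
  have h1 := (tendsto_rpow_atTop (sub_pos.2 hs)).comp tendsto_natCast_atTop_atTop
  obtain ⟨P, hP, hP2, hPC⟩ := ((h1.eventually_ge_atTop ((5 : ℝ) ^ s)).and
    ((Filter.eventually_ge_atTop 2).and (Filter.eventually_ge_atTop C))).exists
  refine ⟨P, hP2, ?_⟩
  have hP0 : (0 : ℝ) < P := by exact_mod_cast (by omega : 0 < P)
  have hPC' : (C : ℝ) ≤ P := by exact_mod_cast hPC
  simp only [Function.comp_apply] at hP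
  calc (4 * P + C : ℝ) ^ s ≤ (5 * P) ^ s := by
        apply rpow_le_rpow (by positivity) (by linarith) hs0.le
    _ = 5 ^ s * (P : ℝ) ^ s := mul_rpow (by norm_num) hP0.le
    _ ≤ (P : ℝ) ^ (1 - s) * (P : ℝ) ^ s := by gcongr
    _ = P := by rw [← rpow_add hP0]; simp

/-- Local bi-Lipschitz bounds near a point of strict differentiability with injective derivative,
together with a lower bound for each coordinate in a direction of nonvanishing derivative. -/
theorem HasStrictFDerivAt.exists_local_bounds {n d : ℕ} (hn : 0 < n) {i₀ : Fin d}
    {F : (Fin d → ℝ) → (Fin n → ℝ)} {L : (Fin d → ℝ) →L[ℝ] (Fin n → ℝ)} {p₀ : Fin d → ℝ}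
    (hF : HasStrictFDerivAt F L p₀) (hinj : Function.Injective L)
    (hnd : ∀ i, L (Pi.single i₀ 1) i ≠ 0) :
    ∃ M > 0, ∃ K : ℝ, 0 < K ∧ ∃ C : ℕ, ∀ᶠ ρ in 𝓝[>] (0 : ℝ),
      ∀ p ∈ Metric.closedBall p₀ ρ, ∀ p' ∈ Metric.closedBall p₀ ρ,
        dist (F p) (F p') ≤ M * dist p p' ∧ dist p p' ≤ K * dist (F p) (F p') ∧
        ∀ i, ∀ h ≥ 0, (∀ j ≠ i₀, |p j - p' j| ≤ h) → |F p i - F p' i| ≤ h →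
          |p i₀ - p' i₀| ≤ C * h := by
  have : Nonempty (Fin n) := ⟨⟨0, hn⟩⟩
  obtain ⟨M, s₁, hs₁, hM⟩ := hF.exists_lipschitzOnWith
  obtain ⟨K, hK, hKL⟩ :=
    (LinearMap.injective_iff_antilipschitz (L : (Fin d → ℝ) →ₗ[ℝ] (Fin n → ℝ))).1 hinj
  obtain ⟨i₂, hi₂⟩ := Finite.exists_min fun i => |L (Pi.single i₀ 1) i|
  set μ := |L (Pi.single i₀ 1) i₂|
  have hμ : 0 < μ := abs_pos.2 (hnd i₂)
  have hK0 : (0 : ℝ) < K := hK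
  obtain ⟨ε, hε0, hε1, hε2⟩ : ∃ ε : NNReal, 0 < ε ∧ (ε : ℝ) ≤ μ / 2 ∧ K * (ε : ℝ) ≤ 1 / 2 := by
    have hmin : (0 : ℝ) < min (μ / 2) (1 / (2 * K)) := by positivity
    refine ⟨⟨min (μ / 2) (1 / (2 * K)), hmin.le⟩, hmin, min_le_left _ _, ?_⟩
    · calc (K : ℝ) * min (μ / 2) (1 / (2 * K)) ≤ K * (1 / (2 * K)) := by
            gcongr; exact min_le_right _ _
        _ = 1 / 2 := by field_simp
  obtain ⟨s₂, hs₂, hA⟩ := hF.approximates_deriv_on_nhds (Or.inr hε0)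
  obtain ⟨C, hC⟩ := exists_nat_ge ((1 + ε + ‖L‖) / (μ / 2))
  rw [div_le_iff₀ (by positivity)] at hC
  refine ⟨M + 1, by positivity, 2 * K, by positivity, C, ?_⟩
  have hev : ∀ᶠ ρ in 𝓝[>] (0 : ℝ), Metric.closedBall p₀ ρ ⊆ s₁ ∩ s₂ := by
    obtain ⟨δ, hδ, hsub⟩ := Metric.nhds_basis_closedBall.mem_iff.1 (Filter.inter_mem hs₁ hs₂)
    filter_upwards [Ioc_mem_nhdsGT hδ] with ρ hρ
    exact (Metric.closedBall_subset_closedBall hρ.2).trans hsub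
  filter_upwards [hev] with ρ hρ p hp p' hp'
  have happ := hA p (hρ hp).2 p' (hρ hp').2
  have hdist : dist p p' = ‖p - p'‖ := dist_eq_norm _ _
  refine ⟨?_, ?_, fun i h hh hj hi => ?_⟩
  · refine (hM.dist_le_mul p (hρ hp).1 p' (hρ hp').1).trans ?_
    gcongr
    linarith
  · have h1 : dist p p' ≤ K * ‖L (p - p')‖ := by
      have := hKL.le_mul_dist p p'
      rwa [dist_eq_norm (_ : Fin n → ℝ), ← map_sub] at this
    have h2 : ‖L (p - p')‖ ≤ dist (F p) (F p') + ε * ‖p - p'‖ := by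
      rw [dist_eq_norm (F p)]
      calc ‖L (p - p')‖ = ‖(F p - F p') - (F p - F p' - L (p - p'))‖ := by congr 1; abel
        _ ≤ ‖F p - F p'‖ + ‖F p - F p' - L (p - p')‖ := norm_sub_le _ _
        _ ≤ _ := by gcongr
    rw [← hdist] at h2
    have h3 : (0 : ℝ) ≤ dist p p' := dist_nonneg
    have h4 : dist p p' ≤ K * (dist (F p) (F p') + ε * dist p p') := h1.trans (by gcongr)
    nlinarith
  · set v := p - p'
    set w := v - v i₀ • (Pi.single i₀ 1 : Fin d → ℝ)
    have hw : ‖w‖ ≤ h := by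
      refine (pi_norm_le_iff_of_nonneg hh).2 fun j => ?_
      by_cases hji : j = i₀
      · subst hji; simpa [w] using hh
      · simpa [w, v, hji] using hj j hji
    have hv : ‖v‖ ≤ |v i₀| + h := by
      have h1 : v = v i₀ • (Pi.single i₀ 1 : Fin d → ℝ) + w := by simp [w]
      have h2 : ‖v i₀ • (Pi.single i₀ 1 : Fin d → ℝ)‖ = |v i₀| := by
        rw [norm_smul, Pi.norm_single]; simp
      calc ‖v‖ = ‖v i₀ • (Pi.single i₀ 1 : Fin d → ℝ) + w‖ := congrArg _ h1
        _ ≤ _ := norm_add_le _ _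
        _ ≤ _ := by rw [h2]; gcongr
    have hLv : v i₀ * L (Pi.single i₀ 1) i = (F p i - F p' i) - (F p - F p' - L v) i - L w i := by
      simp [w]
    have hLw : |L w i| ≤ ‖L‖ * h :=
      (norm_le_pi_norm (L w) i).trans ((L.le_opNorm w).trans (by gcongr))
    have herr : |(F p - F p' - L v) i| ≤ ε * (|v i₀| + h) :=
      (norm_le_pi_norm _ i).trans (happ.trans (by gcongr))
    have hμi : |v i₀| * μ ≤ |v i₀ * L (Pi.single i₀ 1) i| := by
      rw [abs_mul]; gcongr; exact hi₂ i
    have htri : |v i₀ * L (Pi.single i₀ 1) i| ≤ h + ε * (|v i₀| + h) + ‖L‖ * h := by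
      rw [hLv]
      refine (abs_sub _ _).trans (add_le_add ((abs_sub _ _).trans (add_le_add hi herr)) hLw)
    have hv0 : 0 ≤ |v i₀| := abs_nonneg _
    have hfin : |v i₀| * (μ / 2) ≤ C * h * (μ / 2) := by
      nlinarith
    exact le_of_mul_le_mul_right hfin (by positivity)

theorem hasStrictFDerivAt_of_contOn {E E' : Type*} [NormedAddCommGroup E] [NormedSpace ℝ E]
    [NormedAddCommGroup E'] [NormedSpace ℝ E'] {V : Set E} (hV : IsOpen V) {F : E → E'}
    {F' : E → E →L[ℝ] E'} (hderiv : ∀ p ∈ V, HasFDerivWithinAt F (F' p) V p)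
    (hcont : ContinuousOn F' V) {p : E} (hp : p ∈ V) : HasStrictFDerivAt F (F' p) p := by
  refine hasStrictFDerivAt_of_hasFDerivAt_of_continuousAt ?_ (hcont.continuousAt (hV.mem_nhds hp))
  filter_upwards [hV.mem_nhds hp] with y hy
  exact (hderiv y hy).hasFDerivAt (hV.mem_nhds hy)

theorem le_of_forall_nnreal_mul_le {a b : ENNReal}
    (h : ∀ s : NNReal, 0 < s → s < 1 → s * a ≤ b) : a ≤ b := by
  have ht : Filter.Tendsto (fun s : NNReal => (s : ENNReal) * a) (𝓝[<] 1) (𝓝 ((1 : NNReal) * a)) :=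
    (ENNReal.Tendsto.mul_const (ENNReal.tendsto_coe.2 Filter.tendsto_id) (Or.inl (by simp))).mono_left
      nhdsWithin_le_nhds
  rw [ENNReal.coe_one, one_mul] at ht
  have : (𝓝[<] (1 : NNReal)).NeBot := nhdsLT_neBot_of_exists_lt ⟨0, zero_lt_one⟩
  refine le_of_tendsto ht ?_
  filter_upwards [Ioo_mem_nhdsLT (zero_lt_one (α := NNReal))] with s hs
  exact h s hs.1 hs.2

/-- The lower bound for the dimension, localized at a point of strict differentiability. -/
theorem mul_le_dimH_iInter_badT_inter_image {n m d : ℕ} (hn : 0 < n) (hm : 0 < m)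
    {k : ℕ → Fin n → ℝ} (hk : ∀ t, IsWeight (k t)) {V : Set (Fin d → ℝ)}
    {F : (Fin d → ℝ) → (Fin n → ℝ)} {L : (Fin d → ℝ) →L[ℝ] (Fin n → ℝ)} {p₀ : Fin d → ℝ}
    (hV : V ∈ 𝓝 p₀) (hF : HasStrictFDerivAt F L p₀) (hinj : Function.Injective L) {i₀ : Fin d}
    (hnd : ∀ i, L (Pi.single i₀ 1) i ≠ 0)
    {Θ : Matrix (Fin n) (Fin m) ℝ} (hΘ : ∀ t, Θ ∈ Bad n m (k t))
    {s : NNReal} (hs0 : 0 < s) (hs1 : s < 1) :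
    (s : ENNReal) * d ≤ dimH ((⋂ t, BadT n m (k t) Θ) ∩ F '' V) := by
  have hs0' : (0 : ℝ) < s := hs0
  obtain ⟨M, hM, K, hK, C, hev⟩ := hF.exists_local_bounds hn hinj hnd
  have hevV : ∀ᶠ ρ in 𝓝[>] (0 : ℝ), Metric.closedBall p₀ ρ ⊆ V := by
    obtain ⟨δ, hδ, hsub⟩ := Metric.nhds_basis_closedBall.mem_iff.1 hV
    filter_upwards [Ioc_mem_nhdsGT hδ] with ρ hρ
    exact (Metric.closedBall_subset_closedBall hρ.2).trans hsub
  obtain ⟨r₀, ⟨⟨hb, hr₀V⟩, hr₀, hr₀M⟩⟩ := ((hev.and hevV).and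
    (Ioc_mem_nhdsGT (show (0 : ℝ) < 1 / (2 * M) by positivity))).exists
  have hMr : M * r₀ ≤ 1 / 2 := by
    rw [le_div_iff₀ (by positivity)] at hr₀M
    linarith
  obtain ⟨P, hP2, hPs⟩ := exists_base C hs0' (show (s : ℝ) < 1 from hs1)
  have hP2' : (2 : ℝ) ≤ P := by exact_mod_cast hP2
  have hC0 : (0 : ℝ) ≤ C := by positivity
  set N : ℝ := 4 * P + C with hN
  have hN1 : 1 < N := by linarith
  have hN0 : 0 < N := by linarith
  obtain ⟨σ, hσ⟩ := exists_schedule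
  choose G hG using hσ
  choose i₁ D hD hDbad using fun t =>
    exists_dangerous_sets hn hm (hk t) (hΘ t) hM hr₀ hMr hN1 (hG t)
  set box : Set (Fin d → ℝ) := {p | ∀ j, p₀ j ≤ p j ∧ p j ≤ p₀ j + r₀}
  have hbox : ∀ p ∈ box, p ∈ Metric.closedBall p₀ r₀ := fun p hp => by
    refine Metric.mem_closedBall.2 ((dist_pi_le_iff hr₀.le).2 fun j => ?_)
    rw [Real.dist_eq, abs_le]
    constructor <;> linarith [(hp j).1, (hp j).2]
  obtain ⟨φ, hφbox, hφB, hφsep⟩ := exists_cantor_avoiding (C := C) i₀ hP2 hr₀ p₀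
    (B := fun l => {p | p ∈ box ∧ F p ∈ D (σ l) l}) (by
      rintro l p ⟨hp, hpD⟩ p' ⟨hp', hpD'⟩ hj hj'
      obtain ⟨hLip, -, hthin⟩ := hb p (hbox p hp) p' (hbox p' hp')
      refine hthin (i₁ (σ l)) _ (by positivity) hj' (hD (σ l) l _ hpD _ hpD' fun i => ?_)
      rw [← Real.dist_eq]
      refine (dist_le_pi_dist _ _ i).trans (hLip.trans ?_)
      gcongr
      exact (dist_pi_le_iff (by positivity)).2 hj)
  have hsub : (F ∘ φ) '' {y | ∀ j, 0 ≤ y j ∧ y j < 1} ⊆ (⋂ t, BadT n m (k t) Θ) ∩ F '' V := by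
    rintro _ ⟨y, -, rfl⟩
    refine ⟨Set.mem_iInter.2 fun t => hDbad t _ ?_, φ y, hr₀V (hbox _ (hφbox y)), rfl⟩
    rintro l rfl hl
    exact hφB y l ⟨hφbox y, hl⟩
  rw [← dimH_unit_cube]
  refine le_trans ?_ (dimH_mono hsub)
  refine mul_dimH_le_dimH_image (C := ⟨P * (K / r₀) ^ (s : ℝ), by positivity⟩) hs0
    fun y hy y' hy' => ?_
  rcases eq_or_ne y y' with rfl | hne
  · rw [dist_self]
    exact mul_nonneg (NNReal.coe_nonneg _) (rpow_nonneg dist_nonneg _)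
  obtain ⟨l, hl1, hl2⟩ := hφsep y y' hy hy' hne
  have hanti := (hb _ (hbox _ (hφbox y)) _ (hbox _ (hφbox y'))).2.1
  have hscale : 1 / N ^ (l + 1) ≤ K / r₀ * dist (F (φ y)) (F (φ y')) := by
    have := hl2.trans hanti
    rw [div_mul_eq_mul_div, le_div_iff₀ hr₀]
    calc 1 / N ^ (l + 1) * r₀ = r₀ / N ^ (l + 1) := by ring
      _ ≤ _ := this
  calc dist y y' ≤ 1 / (P : ℝ) ^ l := hl1
    _ = P * (1 / (P : ℝ) ^ (l + 1)) := by rw [pow_succ]; field_simp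
    _ ≤ P * (1 / (N ^ (s : ℝ)) ^ (l + 1)) := by gcongr
    _ = P * (1 / N ^ (l + 1)) ^ (s : ℝ) := by
      rw [div_rpow zero_le_one (by positivity), one_rpow, rpow_pow_comm hN0.le]
    _ ≤ P * (K / r₀ * dist (F (φ y)) (F (φ y'))) ^ (s : ℝ) := by gcongr
    _ = P * (K / r₀) ^ (s : ℝ) * dist (F (φ y)) (F (φ y')) ^ (s : ℝ) := by
      rw [mul_rpow (by positivity) dist_nonneg]; ring

/-- (Fibering version of the Corollary.) Let `1 ≤ d ≤ n`, let
`V ⊆ ℝᵈ` be nonempty open, `F : V → ℝⁿ` a `C¹` map which is a homeomorphism onto its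
image with everywhere injective differential, and suppose each curve `x ↦ F(x,y)`
(first coordinate varying) has all `n` coordinate derivatives nonvanishing on `V`.
Then for `Θ ∈ ⋂ₜ Bad(kₜ,n,m)`, `dim_H (⋂ₜ Bad_Θ(kₜ,n,m) ∩ F(V)) = d`. -/
theorem iInter_badT_inter_manifold_dimH {n m d : ℕ} (hn : 0 < n) (hm : 0 < m)
    (hd : 0 < d) (hdn : d ≤ n)
    (k : ℕ → Fin n → ℝ) (hk : ∀ t, IsWeight (k t))
    (V : Set (Fin d → ℝ)) (hV : IsOpen V) (hVne : V.Nonempty)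
    (F : (Fin d → ℝ) → (Fin n → ℝ))
    (F' : (Fin d → ℝ) → ((Fin d → ℝ) →L[ℝ] (Fin n → ℝ)))
    (hderiv : ∀ p ∈ V, HasFDerivWithinAt F (F' p) V p)
    (hcont : ContinuousOn F' V)
    (hhomeo : Topology.IsEmbedding (V.restrict F))
    (hinj : ∀ p ∈ V, Function.Injective (F' p))
    (hnd : ∀ p ∈ V, ∀ i : Fin n, F' p (Pi.single (⟨0, hd⟩ : Fin d) 1) i ≠ 0)
    (Θ : Matrix (Fin n) (Fin m) ℝ) (hΘ : ∀ t, Θ ∈ Bad n m (k t)) :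
    dimH ((⋂ t, BadT n m (k t) Θ) ∩ F '' V) = d := by
  apply le_antisymm
  · have hstrict : ∀ p ∈ V, HasStrictFDerivAt F (F' p) p := fun p hp =>
      hasStrictFDerivAt_of_contOn hV hderiv hcont hp
    refine (dimH_mono Set.inter_subset_right).trans
      ((dimH_image_le_of_locally_lipschitzOn fun p hp => ?_).trans
        ((dimH_mono (Set.subset_univ V)).trans (dimH_univ_pi_fin d).le))
    obtain ⟨K, s, hs, hK⟩ := (hstrict p hp).exists_lipschitzOnWith
    exact ⟨K, s, mem_nhdsWithin_of_mem_nhds hs, hK⟩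
  · obtain ⟨p₀, hp₀⟩ := hVne
    refine le_of_forall_nnreal_mul_le fun s hs0 hs1 => ?_
    exact mul_le_dimH_iInter_badT_inter_image hn hm hk (hV.mem_nhds hp₀)
      (hasStrictFDerivAt_of_contOn hV hderiv hcont hp₀) (hinj p₀ hp₀) (hnd p₀ hp₀) hΘ hs0 hs1
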